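/- Let (X_k)_{1 ≤ k ≤ n} be independent identically distributed real random variables with E[X_1] = 0, E[X_1²] = 1 and E[X_1⁴] < ∞, and let (a_{k,l})_{1 ≤ k,l ≤ n} be a symmetric real matrix with vanishing diagonal. Set Q_n := Σ_{1 ≤ k,l ≤ n} a_{k,l} X_k X_l and assume E[Q_n²] = 1. Then d_W(Q_n, 𝒩) ≤ 2 √( E[X_1⁴] Σ_{l=1}^n (Σ_{k=1}^n a_{k,l}²)² + 2 Σ_{1 ≤ l,p ≤ n} (Σ_{k=1}^n a_{k,l} a_{k,p})² ) + 4 √( (3 E[X_1⁴] + (E[X_1⁴])²) Σ_{k=1}^n (Σ_{l=1}^n a_{k,l}²)² ). -/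

import Mathlib

open MeasureTheory ProbabilityTheory

/-- Wasserstein distance between two laws on `ℝ`, as a supremum over
1-Lipschitz test functions. -/
noncomputable def dW (μ ν : Measure ℝ) : ℝ :=
  ⨆ h : {f : ℝ → ℝ // LipschitzWith 1 f}, |(∫ x, h.1 x ∂μ) - ∫ x, h.1 x ∂ν|

/-- The standard Gaussian law `N(0,1)` on `ℝ`. -/
noncomputable def stdGaussian : Measure ℝ := gaussianReal 0 1

section SteinEquation

open Set Filter

local notation "φ" => gaussianPDFReal 0 1

lemma hasDerivAt_stdGaussianPDF (x : ℝ) : HasDerivAt φ (-x * φ x) x := by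
  simp only [gaussianPDFReal_def]
  have h : HasDerivAt (fun x : ℝ => -(x - 0) ^ 2 / (2 * ((1 : NNReal) : ℝ))) (-x) x := by
    have := ((((hasDerivAt_id x).sub_const 0).pow 2).neg.div_const (2 * ((1 : NNReal) : ℝ)))
    refine this.congr_deriv ?_
    simp
    ring
  refine (h.exp.const_mul _).congr_deriv ?_
  ring

lemma stdGaussianPDF_pos (x : ℝ) : 0 < φ x := gaussianPDFReal_pos 0 1 x one_ne_zero

lemma stdGaussianPDF_neg (x : ℝ) : φ (-x) = φ x := by
  simp [gaussianPDFReal_def]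

lemma integrable_stdGaussianPDF_mul {g : ℝ → ℝ} (hg : Integrable g (gaussianReal 0 1)) :
    Integrable (fun y => φ y * g y) := by
  rw [gaussianReal_of_var_ne_zero 0 one_ne_zero] at hg
  rw [integrable_withDensity_iff_integrable_smul' (measurable_gaussianPDF 0 1)
    (ae_of_all _ fun x => by simp [gaussianPDF])] at hg
  simpa [gaussianPDF, ENNReal.toReal_ofReal (gaussianPDFReal_nonneg 0 1 _)] using hg

lemma integral_stdGaussianPDF_mul (g : ℝ → ℝ) :
    ∫ y, φ y * g y = ∫ y, g y ∂(gaussianReal 0 1) := by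
  rw [integral_gaussianReal_eq_integral_smul one_ne_zero]
  rfl

lemma integrable_pow_gaussian (n : ℕ) : Integrable (fun y : ℝ => y ^ n) (gaussianReal 0 1) := by
  have := (memLp_id_gaussianReal (μ := 0) (v := 1) n).integrable_norm_pow'
  refine this.mono' (by fun_prop) (ae_of_all _ fun x => by simp)

lemma integrable_gaussian_of_lipschitz {h : ℝ → ℝ} (hh : LipschitzWith 1 h) :
    Integrable h (gaussianReal 0 1) := by
  have h1 := (integrable_pow_gaussian 1).norm
  refine ((integrable_const |h 0|).add h1).mono' hh.continuous.aestronglyMeasurable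
    (ae_of_all _ fun x => ?_)
  have := hh.dist_le_mul x 0
  simp only [Real.dist_eq, NNReal.coe_one, one_mul, sub_zero] at this
  have h2 := abs_sub_abs_le_abs_sub (h x) (h 0)
  simp only [Real.norm_eq_abs, pow_one, Pi.add_apply]
  linarith

lemma integral_sq_gaussian : ∫ y : ℝ, y ^ 2 ∂(gaussianReal 0 1) = 1 := by
  have h := variance_id_gaussianReal (μ := 0) (v := 1)
  rw [variance_of_integral_eq_zero aemeasurable_id (by simp)] at h
  simpa using h

lemma integrable_pow_stdGaussianPDF (n : ℕ) : Integrable (fun y : ℝ => φ y * y ^ n) :=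
  integrable_stdGaussianPDF_mul (integrable_pow_gaussian n)

lemma integral_Ioi_id_stdGaussianPDF (x : ℝ) : ∫ y in Ioi x, φ y * y = φ x := by
  have hd : ∀ y ∈ Ioi x, HasDerivAt (fun y => - φ y) (φ y * y) y := fun y _ => by
    refine (hasDerivAt_stdGaussianPDF y).neg.congr_deriv ?_
    ring
  have h1 : IntegrableOn (fun y : ℝ => φ y * y) (Ioi x) := by
    simpa using (integrable_pow_stdGaussianPDF 1).integrableOn
  have h0 : IntegrableOn (fun y => - φ y) (Ioi x) := by
    simpa using (integrable_pow_stdGaussianPDF 0).neg.integrableOn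
  have ht := tendsto_zero_of_hasDerivAt_of_integrableOn_Ioi hd h1 h0
  have := integral_Ioi_of_hasDerivAt_of_tendsto
    (hasDerivAt_stdGaussianPDF x).neg.continuousAt.continuousWithinAt hd h1 ht
  simpa using this

lemma integral_Ioi_sq_stdGaussianPDF (x : ℝ) :
    ∫ y in Ioi x, φ y * y ^ 2 = x * φ x + ∫ y in Ioi x, φ y := by
  have hd : ∀ y, HasDerivAt (fun y => - (φ y * y)) (φ y * y ^ 2 - φ y) y := fun y => by
    refine ((hasDerivAt_stdGaussianPDF y).mul (hasDerivAt_id y)).neg.congr_deriv ?_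
    simp
    ring
  have h2 : IntegrableOn (fun y : ℝ => φ y * y ^ 2) (Ioi x) :=
    (integrable_pow_stdGaussianPDF 2).integrableOn
  have h1 : IntegrableOn (fun y : ℝ => - (φ y * y)) (Ioi x) := by
    simpa using (integrable_pow_stdGaussianPDF 1).neg.integrableOn
  have h0 : IntegrableOn (fun y : ℝ => φ y) (Ioi x) := by
    simpa using (integrable_pow_stdGaussianPDF 0).integrableOn
  have ht := tendsto_zero_of_hasDerivAt_of_integrableOn_Ioi (fun y _ => hd y) (h2.sub h0) h1
  have := integral_Ioi_of_hasDerivAt_of_tendsto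
    (hd x).continuousAt.continuousWithinAt (fun y _ => hd y) (h2.sub h0) ht
  rw [integral_sub h2 h0] at this
  linarith

lemma integral_Ioi_quadratic_nonneg (x a b : ℝ) :
    0 ≤ (a ^ 2 + b ^ 2 + (b * x) ^ 2 - 2 * a * b * x) * (∫ y in Ioi x, φ y)
      + (2 * a * b - b ^ 2 * x) * φ x := by
  have h2 : IntegrableOn (fun y : ℝ => φ y * y ^ 2) (Ioi x) :=
    (integrable_pow_stdGaussianPDF 2).integrableOn
  have h1 : IntegrableOn (fun y : ℝ => φ y * y) (Ioi x) := by
    simpa using (integrable_pow_stdGaussianPDF 1).integrableOn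
  have h0 : IntegrableOn (fun y : ℝ => φ y) (Ioi x) := by
    simpa using (integrable_pow_stdGaussianPDF 0).integrableOn
  have hnn : 0 ≤ ∫ y in Ioi x, (b ^ 2 * (φ y * y ^ 2) + 2 * b * (a - b * x) * (φ y * y)
      + (a - b * x) ^ 2 * φ y) := by
    refine integral_nonneg fun y => ?_
    have : b ^ 2 * (φ y * y ^ 2) + 2 * b * (a - b * x) * (φ y * y) + (a - b * x) ^ 2 * φ y
        = φ y * (a + b * (y - x)) ^ 2 := by ring
    simp only [this, Pi.zero_apply]
    exact mul_nonneg (stdGaussianPDF_pos y).le (sq_nonneg _)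
  have h21 : IntegrableOn (fun y : ℝ => b ^ 2 * (φ y * y ^ 2)
      + 2 * b * (a - b * x) * (φ y * y)) (Ioi x) := (h2.const_mul _).add (h1.const_mul _)
  rw [integral_add h21 (h0.const_mul _),
    integral_add (h2.const_mul _) (h1.const_mul _), integral_const_mul, integral_const_mul,
    integral_const_mul, integral_Ioi_sq_stdGaussianPDF, integral_Ioi_id_stdGaussianPDF] at hnn
  linarith

/-- Mills ratio lower bound. -/
lemma mills_lower (x : ℝ) : x * φ x ≤ (1 + x ^ 2) * ∫ y in Ioi x, φ y := by
  have := integral_Ioi_quadratic_nonneg x 0 1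
  linarith

/-- Refined Mills ratio bound, from the Cauchy–Schwarz inequality. -/
lemma mills_quadratic (x : ℝ) :
    φ x ^ 2 ≤ (∫ y in Ioi x, φ y) ^ 2 + x * (∫ y in Ioi x, φ y) * φ x := by
  set J := ∫ y in Ioi x, φ y
  have hJ : 0 ≤ J := integral_nonneg fun y => (stdGaussianPDF_pos y).le
  have hφ := stdGaussianPDF_pos x
  rcases hJ.eq_or_lt with h0 | hpos
  · have := integral_Ioi_quadratic_nonneg x (x - 1) 1
    have h' := integral_Ioi_quadratic_nonneg x 0 1
    change 0 ≤ _ * J + _ at this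
    change 0 ≤ _ * J + _ at h'
    rw [← h0] at this h'
    nlinarith
  · have h1 := integral_Ioi_quadratic_nonneg x (-(φ x - x * J)) J
    change 0 ≤ _ * J + _ at h1
    have h2 : 0 ≤ J * (J ^ 2 + x * J * φ x - φ x ^ 2) := by
      linarith
    have := nonneg_of_mul_nonneg_right h2 hpos
    linarith

section Solution

variable {g : ℝ → ℝ}

lemma integral_Iic_stein_eq_neg (hg : Integrable (fun y => φ y * g y))
    (h0 : ∫ y, φ y * g y = 0) (x : ℝ) :
    ∫ y in Iic x, φ y * g y = - ∫ y in Ioi x, φ y * g y := by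
  have := integral_add_compl (measurableSet_Iic (a := x)) hg
  rw [compl_Iic] at this
  linarith

lemma integral_Iic_stein_comp_neg (hg : Integrable (fun y => φ y * g y))
    (h0 : ∫ y, φ y * g y = 0) (x : ℝ) :
    ∫ y in Iic x, φ y * g (-y) = - ∫ y in Iic (-x), φ y * g y := by
  have := integral_comp_neg_Iic x (fun y => φ y * g y)
  simp only [stdGaussianPDF_neg] at this
  rw [this, integral_Iic_stein_eq_neg hg h0, neg_neg]

lemma integral_Iic_stein_nonpos (hmono : Monotone g) (hg : Integrable (fun y => φ y * g y))
    (h0 : ∫ y, φ y * g y = 0) (x : ℝ) : ∫ y in Iic x, φ y * g y ≤ 0 := by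
  rcases le_total (g x) 0 with h | h
  · exact setIntegral_nonpos measurableSet_Iic fun y hy =>
      mul_nonpos_of_nonneg_of_nonpos (stdGaussianPDF_pos y).le ((hmono hy).trans h)
  · rw [integral_Iic_stein_eq_neg hg h0, neg_nonpos]
    exact setIntegral_nonneg measurableSet_Ioi fun y hy =>
      mul_nonneg (stdGaussianPDF_pos y).le (h.trans (hmono (le_of_lt hy)))

lemma stein_second_order_nonpos_of_nonneg (hmono : Monotone g)
    (hg : Integrable (fun y => φ y * g y)) (h0 : ∫ y, φ y * g y = 0) {x : ℝ} (hx : 0 ≤ x) :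
    (1 + x ^ 2) * (∫ y in Iic x, φ y * g y) + x * (φ x * g x) ≤ 0 := by
  have hφ := stdGaussianPDF_pos x
  rcases le_total (g x) 0 with h | h
  · have h1 := integral_Iic_stein_nonpos hmono hg h0 x
    have h2 : x * (φ x * g x) ≤ 0 :=
      mul_nonpos_of_nonneg_of_nonpos hx (mul_nonpos_of_nonneg_of_nonpos hφ.le h)
    nlinarith [sq_nonneg x]
  · have h1 : g x * ∫ y in Ioi x, φ y ≤ ∫ y in Ioi x, φ y * g y := by
      rw [← integral_const_mul]
      have hφi : IntegrableOn (fun y : ℝ => φ y) (Ioi x) := by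
        simpa using (integrable_pow_stdGaussianPDF 0).integrableOn
      refine setIntegral_mono_on (hφi.const_mul _) hg.integrableOn measurableSet_Ioi
        fun y hy => ?_
      rw [mul_comm]
      exact mul_le_mul_of_nonneg_left (hmono (le_of_lt hy)) (stdGaussianPDF_pos y).le
    rw [integral_Iic_stein_eq_neg hg h0]
    have h2 := mul_le_mul_of_nonneg_left (mills_lower x) h
    nlinarith [mul_le_mul_of_nonneg_left h1 (by positivity : 0 ≤ 1 + x ^ 2)]

lemma stein_second_order_nonpos (hmono : Monotone g) (hg : Integrable (fun y => φ y * g y))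
    (h0 : ∫ y, φ y * g y = 0) (x : ℝ) :
    (1 + x ^ 2) * (∫ y in Iic x, φ y * g y) + x * (φ x * g x) ≤ 0 := by
  rcases le_total 0 x with hx | hx
  · exact stein_second_order_nonpos_of_nonneg hmono hg h0 hx
  · have hmono' : Monotone (fun y => - g (-y)) := fun a b hab =>
      neg_le_neg (hmono (neg_le_neg hab))
    have hg' : Integrable (fun y => φ y * (- g (-y))) := by
      have := hg.comp_neg.neg
      refine this.congr (ae_of_all _ fun y => ?_)
      simp [stdGaussianPDF_neg]
    have h0' : ∫ y, φ y * (- g (-y)) = 0 := by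
      have := integral_neg_eq_self (fun y => φ y * g y) volume
      simp only [stdGaussianPDF_neg] at this
      simp only [mul_neg, integral_neg, this, h0, neg_zero]
    have := stein_second_order_nonpos_of_nonneg hmono' hg' h0' (x := -x) (by linarith)
    simp only [mul_neg, integral_neg, integral_Iic_stein_comp_neg hg h0, neg_neg,
      stdGaussianPDF_neg] at this
    linarith

end Solution

section Lipschitz

variable {g : ℝ → ℝ}

lemma monotone_id_add_of_lipschitz (hlip : LipschitzWith 1 g) :
    Monotone (fun y => y + g y) := fun a b hab => by
  have := hlip.dist_le_mul a b
  rw [Real.dist_eq, Real.dist_eq, abs_sub_comm a b, abs_of_nonneg (sub_nonneg.2 hab)] at this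
  have h2 := le_abs_self (g a - g b)
  simp only [NNReal.coe_one, one_mul] at this
  change a + g a ≤ b + g b
  linarith

lemma integral_Iic_id_stdGaussianPDF (x : ℝ) : ∫ y in Iic x, φ y * y = - φ x := by
  have hi : Integrable (fun y => φ y * y) := by simpa using integrable_pow_stdGaussianPDF 1
  rw [integral_Iic_stein_eq_neg hi (by rw [integral_stdGaussianPDF_mul]; simp),
    integral_Ioi_id_stdGaussianPDF]

lemma stein_one_sided (hlip : LipschitzWith 1 g)
    (h0 : ∫ y, g y ∂(gaussianReal 0 1) = 0) (x : ℝ) :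
    (∫ y in Iic x, φ y * g y) ≤ φ x ∧
    (1 + x ^ 2) * (∫ y in Iic x, φ y * g y) + x * (φ x * g x) ≤ φ x := by
  have hg := integrable_stdGaussianPDF_mul (integrable_gaussian_of_lipschitz hlip)
  have hi : Integrable (fun y => φ y * y) := by simpa using integrable_pow_stdGaussianPDF 1
  have hmono := monotone_id_add_of_lipschitz hlip
  have hadd : ∀ y, φ y * (y + g y) = φ y * y + φ y * g y := fun y => mul_add _ _ _
  have hs : Integrable (fun y => φ y * (y + g y)) := by
    simp only [hadd]
    exact hi.add hg
  have hs0 : ∫ y, φ y * (y + g y) = 0 := by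
    simp only [hadd]
    rw [integral_add hi hg, integral_stdGaussianPDF_mul, integral_stdGaussianPDF_mul, h0]
    simp
  have hF : ∫ y in Iic x, φ y * (y + g y) = - φ x + ∫ y in Iic x, φ y * g y := by
    simp only [hadd]
    rw [integral_add hi.integrableOn hg.integrableOn, integral_Iic_id_stdGaussianPDF]
  have h1 := integral_Iic_stein_nonpos hmono hs hs0 x
  have h2 := stein_second_order_nonpos hmono hs hs0 x
  rw [hF] at h1 h2
  constructor <;> linarith

lemma stein_bounds (hlip : LipschitzWith 1 g)
    (h0 : ∫ y, g y ∂(gaussianReal 0 1) = 0) (x : ℝ) :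
    |∫ y in Iic x, φ y * g y| ≤ φ x ∧
    |(1 + x ^ 2) * (∫ y in Iic x, φ y * g y) + x * (φ x * g x)| ≤ φ x := by
  have h1 := stein_one_sided hlip h0 x
  have h2 := stein_one_sided (g := fun y => - g y) hlip.neg
    (by rw [integral_neg, h0, neg_zero]) x
  simp only [mul_neg, integral_neg] at h2
  constructor
  · exact abs_le.2 ⟨by linarith [h2.1], h1.1⟩
  · exact abs_le.2 ⟨by linarith [h2.2], h1.2⟩

lemma abs_le_sqrt_of_lipschitz (hlip : LipschitzWith 1 g)
    (h0 : ∫ y, g y ∂(gaussianReal 0 1) = 0) (x : ℝ) : |g x| ≤ √(1 + x ^ 2) := by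
  have hgi := integrable_gaussian_of_lipschitz hlip
  set c := √(1 + x ^ 2) with hc
  have hcpos : 0 < c := by positivity
  have hcsq : c ^ 2 = 1 + x ^ 2 := Real.sq_sqrt (by positivity)
  have h2 := integrable_pow_gaussian 2
  have h1 : Integrable (fun y : ℝ => y) (gaussianReal 0 1) := by
    simpa using integrable_pow_gaussian 1
  have hgx : g x = ∫ y, (g x - g y) ∂(gaussianReal 0 1) := by
    rw [integral_sub (integrable_const _) hgi, h0]
    simp
  rw [hgx, ← Real.norm_eq_abs]
  refine (norm_integral_le_of_norm_le
    (g := fun y => (2 * c)⁻¹ * y ^ 2 + (-(x / c) * y + (c / 2 + x ^ 2 / (2 * c))))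
    ((h2.const_mul _).add ((h1.const_mul _).add (integrable_const _)))
    (ae_of_all _ fun y => ?_)).trans ?_
  · have := hlip.dist_le_mul x y
    simp only [Real.dist_eq, NNReal.coe_one, one_mul] at this
    rw [Real.norm_eq_abs]
    refine this.trans ?_
    have : (2 * c)⁻¹ * y ^ 2 + (-(x / c) * y + (c / 2 + x ^ 2 / (2 * c))) - |x - y|
        = (c - |x - y|) ^ 2 / (2 * c) := by
      have := sq_abs (x - y)
      field_simp
      linear_combination -this
    have : 0 ≤ (c - |x - y|) ^ 2 / (2 * c) := by positivity
    linarith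
  · have h10 : Integrable (fun y => -(x / c) * y + (c / 2 + x ^ 2 / (2 * c)))
        (gaussianReal 0 1) := (h1.const_mul _).add (integrable_const _)
    rw [integral_add (h2.const_mul _) h10,
      integral_add (h1.const_mul _) (integrable_const _), integral_const_mul, integral_const_mul,
      integral_sq_gaussian, integral_id_gaussianReal]
    simp only [integral_const, probReal_univ, smul_eq_mul]
    apply le_of_eq
    field_simp
    linarith

lemma stein_first_order_of_nonneg (hlip : LipschitzWith 1 g)
    (h0 : ∫ y, g y ∂(gaussianReal 0 1) = 0) {x : ℝ} (hx : 0 ≤ x) :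
    |x * (∫ y in Iic x, φ y * g y) + φ x * g x| ≤ φ x := by
  have hg := integrable_stdGaussianPDF_mul (integrable_gaussian_of_lipschitz hlip)
  have hi1 : IntegrableOn (fun y => φ y * y) (Ioi x) := by
    simpa using (integrable_pow_stdGaussianPDF 1).integrableOn
  have hi0 : IntegrableOn (fun y : ℝ => φ y) (Ioi x) := by
    simpa using (integrable_pow_stdGaussianPDF 0).integrableOn
  set J := ∫ y in Ioi x, φ y with hJdef
  have hJ : 0 ≤ J := integral_nonneg fun y => (stdGaussianPDF_pos y).le
  have hφ := stdGaussianPDF_pos x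
  have hdiff : |∫ y in Ioi x, (φ y * g y - g x * φ y)| ≤ φ x - x * J := by
    have hr : ∫ y in Ioi x, (φ y * y - x * φ y) = φ x - x * J := by
      rw [integral_sub hi1 (hi0.const_mul _), integral_Ioi_id_stdGaussianPDF, integral_const_mul]
    rw [← hr, ← Real.norm_eq_abs]
    refine norm_integral_le_of_norm_le (hi1.sub (hi0.const_mul _)) ?_
    filter_upwards [ae_restrict_mem measurableSet_Ioi] with y hy
    have := hlip.dist_le_mul y x
    simp only [Real.dist_eq, NNReal.coe_one, one_mul] at this
    rw [abs_of_nonneg (sub_nonneg.2 (le_of_lt (mem_Ioi.1 hy)))] at this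
    have e : φ y * g y - g x * φ y = φ y * (g y - g x) := by ring
    rw [e, Real.norm_eq_abs, abs_mul, abs_of_pos (stdGaussianPDF_pos y)]
    nlinarith [stdGaussianPDF_pos y]
  rw [integral_sub hg.integrableOn (hi0.const_mul _), integral_const_mul] at hdiff
  have hm : 0 ≤ φ x - x * J := (abs_nonneg _).trans hdiff
  set s := √(1 + x ^ 2) with hs
  have hspos : 0 < s := by positivity
  have hssq : s ^ 2 = 1 + x ^ 2 := Real.sq_sqrt (by positivity)
  have hgx := abs_le_sqrt_of_lipschitz hlip h0 x
  rw [integral_Iic_stein_eq_neg hg (by rw [integral_stdGaussianPDF_mul, h0])]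
  have hxs : x ≤ s := by nlinarith
  have key : (φ x - x * J) * (s + x) ≤ φ x := by
    have hq := mills_quadratic x
    change φ x ^ 2 ≤ J ^ 2 + x * J * φ x at hq
    have hgoal : φ x - x * J + x * φ x ≤ s * φ x := by
      rcases le_total (φ x) J with hle | hle
      · have hs1 : 1 ≤ s := by nlinarith
        nlinarith [mul_nonneg hx (sub_nonneg.2 hle), mul_nonneg (sub_nonneg.2 hs1) hφ.le]
      · refine le_of_abs_le (abs_le_of_sq_le_sq ?_ (by positivity))
        rw [mul_pow, hssq]
        have h1 : 2 * (φ x - J) * φ x ^ 2 ≤ x * J * (2 * φ x - J) * φ x := by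
          have a1 : (φ x ^ 2 - J ^ 2) * (2 * φ x - J) ≤ x * J * φ x * (2 * φ x - J) :=
            mul_le_mul_of_nonneg_right (by linarith) (by linarith)
          have a2 : 0 ≤ (φ x - J) * (J * (φ x - J)) :=
            mul_nonneg (by linarith) (mul_nonneg hJ (by linarith))
          nlinarith
        have h2 : 2 * (φ x - J) * φ x ≤ x * J * (2 * φ x - J) :=
          le_of_mul_le_mul_right (by nlinarith) hφ
        nlinarith
    have : (φ x - x * J) * (s + x) * (s - x) ≤ φ x * (s - x) := by
      nlinarith
    have hlt : 0 < s - x := by nlinarith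
    exact le_of_mul_le_mul_right this hlt
  have e : x * -(∫ y in Ioi x, φ y * g y) + φ x * g x
      = g x * (φ x - x * J) - x * ((∫ y in Ioi x, φ y * g y) - g x * J) := by ring
  rw [e]
  refine (abs_sub _ _).trans ?_
  rw [abs_mul, abs_mul, abs_of_nonneg hm, abs_of_nonneg hx]
  nlinarith

lemma stein_first_order (hlip : LipschitzWith 1 g)
    (h0 : ∫ y, g y ∂(gaussianReal 0 1) = 0) (x : ℝ) :
    |x * (∫ y in Iic x, φ y * g y) + φ x * g x| ≤ φ x := by
  rcases le_total 0 x with hx | hx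
  · exact stein_first_order_of_nonneg hlip h0 hx
  · have hg := integrable_stdGaussianPDF_mul (integrable_gaussian_of_lipschitz hlip)
    have hlip' : LipschitzWith 1 (fun y => g (-y)) := by
      have := hlip.comp LipschitzWith.id.neg
      rwa [one_mul] at this
    have h0' : ∫ y, g (-y) ∂(gaussianReal 0 1) = 0 := by
      rw [← integral_stdGaussianPDF_mul] at h0 ⊢
      have := integral_neg_eq_self (fun y => φ y * g y) volume
      simp only [stdGaussianPDF_neg] at this
      rw [this, h0]
    have := stein_first_order_of_nonneg hlip' h0' (x := -x) (by linarith)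
    rw [integral_Iic_stein_comp_neg hg (by rw [integral_stdGaussianPDF_mul, h0])] at this
    simpa [stdGaussianPDF_neg] using this

end Lipschitz

/-- Solution of Stein's equation for a `1`-Lipschitz test function, with the classical bounds. -/
theorem exists_stein_solution {h : ℝ → ℝ} (hh : LipschitzWith 1 h) :
    ∃ f f' : ℝ → ℝ, (∀ x, HasDerivAt f (f' x) x) ∧
      (∀ x, f' x - x * f x = h x - ∫ y, h y ∂(gaussianReal 0 1)) ∧
      (∀ x, |f x| ≤ 1) ∧ (∀ x, |f' x| ≤ 1) ∧ ∀ x y, |f' x - f' y| ≤ 2 * |x - y| := by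
  have hhi := integrable_gaussian_of_lipschitz hh
  set c := ∫ y, h y ∂(gaussianReal 0 1) with hc
  set g : ℝ → ℝ := fun y => h y - c with hgdef
  have hlip : LipschitzWith 1 g := by
    simpa using hh.sub (LipschitzWith.const c)
  have h0 : ∫ y, g y ∂(gaussianReal 0 1) = 0 := by
    rw [integral_sub hhi (integrable_const _)]
    simp [hc]
  have hg := integrable_stdGaussianPDF_mul (integrable_gaussian_of_lipschitz hlip)
  set F : ℝ → ℝ := fun x => ∫ y in Iic x, φ y * g y with hF
  have hcont : Continuous (fun y => φ y * g y) :=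
    (continuous_iff_continuousAt.2 fun x => (hasDerivAt_stdGaussianPDF x).continuousAt).mul
      hlip.continuous
  have hFd : ∀ x, HasDerivAt F (φ x * g x) x := fun x => by
    have : F = fun x => F 0 + ∫ y in (0 : ℝ)..x, φ y * g y := by
      funext z
      rw [← intervalIntegral.integral_Iic_sub_Iic hg.integrableOn hg.integrableOn]
      simp [hF]
    rw [this]
    exact (intervalIntegral.integral_hasDerivAt_right (hcont.intervalIntegrable _ _)
      (hcont.stronglyMeasurableAtFilter _ _) hcont.continuousAt).const_add _
  have hfd : ∀ x, HasDerivAt (fun x => F x / φ x) (x * (F x / φ x) + g x) x := fun x => by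
    have hφ := (stdGaussianPDF_pos x).ne'
    refine ((hFd x).div (hasDerivAt_stdGaussianPDF x) hφ).congr_deriv ?_
    field_simp
    ring
  have hdiv : ∀ (a : ℝ) x, |a * φ x| ≤ φ x → |a| ≤ 1 := fun a x ha => by
    have hφ := stdGaussianPDF_pos x
    rw [abs_mul, abs_of_pos hφ] at ha
    exact le_of_mul_le_mul_right (by linarith) hφ
  refine ⟨fun x => F x / φ x, fun x => x * (F x / φ x) + g x, hfd, fun x => by simp [hgdef],
    fun x => hdiv _ x ?_, fun x => hdiv _ x ?_, fun x y => ?_⟩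
  · rw [div_mul_cancel₀ _ (stdGaussianPDF_pos x).ne']
    exact (stein_bounds hlip h0 x).1
  · have hφ := (stdGaussianPDF_pos x).ne'
    convert stein_first_order hlip h0 x using 2
    field_simp
    ring
  · have hu : ∀ x, HasDerivAt (fun x => x * (F x / φ x))
        (F x / φ x + x * (x * (F x / φ x) + g x)) x := fun x => by
      refine ((hasDerivAt_id x).mul (hfd x)).congr_deriv ?_
      simp
    have hb : ∀ x, ‖F x / φ x + x * (x * (F x / φ x) + g x)‖ ≤ 1 := fun x => by
      refine hdiv _ x ?_
      have hφ := (stdGaussianPDF_pos x).ne'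
      convert (stein_bounds hlip h0 x).2 using 2
      field_simp
      ring
    have h1 := (convex_univ (𝕜 := ℝ) (E := ℝ)).norm_image_sub_le_of_norm_hasDerivWithin_le
      (fun z _ => (hu z).hasDerivWithinAt) (fun z _ => hb z) (mem_univ y) (mem_univ x)
    have h2 := hlip.dist_le_mul x y
    simp only [Real.dist_eq, Real.norm_eq_abs, NNReal.coe_one, one_mul] at h1 h2
    have e : x * (F x / φ x) + g x - (y * (F y / φ y) + g y)
        = (x * (F x / φ x) - y * (F y / φ y)) + (g x - g y) := by ring
    rw [e]
    exact (abs_add_le _ _).trans (by linarith)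

end SteinEquation

section OneDimensional

variable {G g : ℝ → ℝ} {L : ℝ}

lemma abs_taylor_le (hG : ∀ x, HasDerivAt G (g x) x) (hL : ∀ x y, |g x - g y| ≤ L * |x - y|)
    (y c : ℝ) : |G c - G y - (c - y) * g y| ≤ L / 2 * (c - y) ^ 2 := by
  have hlip : Continuous g := by
    refine (LipschitzWith.of_dist_le_mul (K := L.toNNReal) fun x y => ?_).continuous
    simp only [Real.dist_eq]
    exact (hL x y).trans (mul_le_mul_of_nonneg_right (Real.le_coe_toNNReal L) (abs_nonneg _))
  have hd : ∀ t : ℝ, HasDerivAt (fun t => G (y + t * (c - y)) - t * ((c - y) * g y))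
      ((c - y) * (g (y + t * (c - y)) - g y)) t := fun t => by
    have h1 : HasDerivAt (fun t => y + t * (c - y)) (c - y) t := by
      simpa using ((hasDerivAt_id t).mul_const (c - y)).const_add y
    have h2 := (hG (y + t * (c - y))).comp t h1
    refine (h2.sub ((hasDerivAt_id t).mul_const ((c - y) * g y))).congr_deriv ?_
    ring
  have hcont : Continuous fun t : ℝ => (c - y) * (g (y + t * (c - y)) - g y) := by fun_prop
  have hftc := intervalIntegral.integral_eq_sub_of_hasDerivAt (a := 0) (b := 1)
    (fun t _ => hd t) (hcont.intervalIntegrable _ _)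
  have e : G c - G y - (c - y) * g y
      = ∫ t in (0 : ℝ)..1, (c - y) * (g (y + t * (c - y)) - g y) := by
    rw [hftc]
    simp
    ring
  have hb : ∫ t in (0 : ℝ)..1, L * (c - y) ^ 2 * t = L / 2 * (c - y) ^ 2 := by
    rw [intervalIntegral.integral_const_mul, integral_id]
    ring
  rw [e, ← hb, ← Real.norm_eq_abs]
  refine intervalIntegral.norm_integral_le_of_norm_le zero_le_one
    (ae_of_all _ fun t ht => ?_) ((by fun_prop : Continuous fun t : ℝ =>
      L * (c - y) ^ 2 * t).intervalIntegrable _ _)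
  rw [Real.norm_eq_abs, abs_mul]
  have := hL (y + t * (c - y)) y
  rw [add_sub_cancel_left, abs_mul, abs_of_pos ht.1] at this
  refine (mul_le_mul_of_nonneg_left this (abs_nonneg _)).trans (le_of_eq ?_)
  linear_combination L * t * sq_abs (c - y)

lemma abs_exchange_le (hG : ∀ x, HasDerivAt G (g x) x) (hL : ∀ x y, |g x - g y| ≤ L * |x - y|)
    (x y : ℝ) : |G x - G y - x * g y + y * g x| ≤ L / 2 * (x ^ 2 + y ^ 2) := by
  have h1 := abs_taylor_le hG hL y (x + y)
  have h2 := abs_taylor_le hG hL x (x + y)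
  simp only [add_sub_cancel_left, add_sub_cancel_right] at h1 h2
  have e : G x - G y - x * g y + y * g x
      = (G (x + y) - G y - x * g y) - (G (x + y) - G x - y * g x) := by ring
  rw [e]
  exact (abs_sub _ _).trans (by linarith)

/-- A quantitative bound for the distance between a centered law of unit variance and its
zero-bias transform. -/
lemma abs_integral_zero_bias_le {μ : Measure ℝ} [IsProbabilityMeasure μ] {m K : ℝ}
    (h4 : MemLp (fun x : ℝ => x) 4 μ) (h1 : ∫ x, x ∂μ = 0) (h2 : ∫ x, x ^ 2 ∂μ = 1)
    (hm : ∫ x, x ^ 4 ∂μ = m)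
    (hG : ∀ x, HasDerivAt G (g x) x) (hL : ∀ x y, |g x - g y| ≤ L * |x - y|) (hL0 : 0 ≤ L)
    (hGb : ∀ x, |G x| ≤ K) (hgb : ∀ x, |g x| ≤ K) :
    |∫ x, (x * G x - g x) ∂μ| ≤ L / 2 * √(m + 1) := by
  have hgc : Continuous g := by
    refine (LipschitzWith.of_dist_le_mul (K := L.toNNReal) fun x y => ?_).continuous
    simp only [Real.dist_eq]
    exact (hL x y).trans (mul_le_mul_of_nonneg_right (Real.le_coe_toNNReal L) (abs_nonneg _))
  have hGc : Continuous G := continuous_iff_continuousAt.2 fun x => (hG x).continuousAt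
  have i4 : Integrable (fun x : ℝ => x ^ 4) μ := by
    refine (h4.integrable_norm_pow (by norm_num)).congr (ae_of_all _ fun x => ?_)
    simp [← abs_pow, abs_of_nonneg (by positivity : 0 ≤ x ^ 4)]
  have i2 : Integrable (fun x : ℝ => x ^ 2) μ := by
    refine ((h4.mono_exponent (p := 2) (by norm_num)).integrable_norm_pow (by norm_num)).congr
      (ae_of_all _ fun x => ?_)
    simp
  have i1 : Integrable (fun x : ℝ => x) μ := h4.integrable (by norm_num)
  have i0 : Integrable (fun _ : ℝ => (1 : ℝ)) μ := integrable_const _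
  have bdd : ∀ {u v : ℝ → ℝ}, Integrable u μ → Continuous v → (∀ x, |v x| ≤ K) →
      Integrable (fun x => u x * v x) μ := fun hu hv hb =>
    hu.mul_bdd hv.aestronglyMeasurable (ae_of_all _ hb)
  have iG : Integrable G μ := by simpa using bdd i0 hGc hGb
  have ig : Integrable g μ := by simpa using bdd i0 hgc hgb
  have i1G := bdd i1 hGc hGb
  have i1g := bdd i1 hgc hgb
  have hm1 : 0 < m + 1 := by
    have : 0 ≤ m := hm ▸ integral_nonneg fun x => by positivity
    linarith
  set c := √(m + 1) with hc
  have hc0 : 0 < c := Real.sqrt_pos.2 hm1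
  have hcsq : c ^ 2 = m + 1 := Real.sq_sqrt hm1.le
  set P : ℝ × ℝ → ℝ := fun p => (p.1 - p.2) * (G p.1 - G p.2 - p.1 * g p.2 + p.2 * g p.1) / 2
  have hP : ∫ p, P p ∂(μ.prod μ) = ∫ x, (x * G x - g x) ∂μ := by
    set A : (ℝ → ℝ) → (ℝ → ℝ) → ℝ × ℝ → ℝ := fun u v p => u p.1 * v p.2 with hA
    have hAi : ∀ {u v : ℝ → ℝ}, Integrable u μ → Integrable v μ →
        Integrable (A u v) (μ.prod μ) := fun hu hv => hu.mul_prod hv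
    have hAv : ∀ u v : ℝ → ℝ, ∫ p, A u v p ∂(μ.prod μ) = (∫ x, u x ∂μ) * ∫ x, v x ∂μ :=
      fun u v => integral_prod_mul u v
    set q1 : ℝ → ℝ := fun x => x
    set q2 : ℝ → ℝ := fun x => x ^ 2
    set qG : ℝ → ℝ := fun x => x * G x
    set qg : ℝ → ℝ := fun x => x * g x
    have e : P = fun p => (A qG (fun _ => 1) + A (fun _ => 1) qG - (A q1 G + A G q1)
        + (A qg q1 + A q1 qg) - (A q2 g + A g q2)) p / 2 := by
      funext p
      simp only [P, hA, q1, q2, qG, qg, Pi.add_apply, Pi.sub_apply]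
      ring
    have a1 := hAi i1G i0
    have a2 := hAi i0 i1G
    have a3 := hAi i1 iG
    have a4 := hAi iG i1
    have a5 := hAi i1g i1
    have a6 := hAi i1 i1g
    have a7 := hAi i2 ig
    have a8 := hAi ig i2
    rw [e, integral_div, integral_sub' (((a1.add a2).sub (a3.add a4)).add (a5.add a6)) (a7.add a8),
      integral_add' ((a1.add a2).sub (a3.add a4)) (a5.add a6),
      integral_sub' (a1.add a2) (a3.add a4),
      integral_add' a1 a2, integral_add' a3 a4, integral_add' a5 a6, integral_add' a7 a8,
      integral_sub i1G ig]
    simp only [hAv, h1, h2]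
    simp
    ring
  have b4 := i4.mul_prod i0
  have b4' := i0.mul_prod i4
  have b22 := i2.mul_prod i2
  have b2 := i2.mul_prod i0
  have b2' := i0.mul_prod i2
  have b11 := i1.mul_prod i1
  have v4 : ∫ p : ℝ × ℝ, p.1 ^ 4 * 1 ∂(μ.prod μ) = m := by
    rw [integral_prod_mul (fun x => x ^ 4) (fun _ => (1 : ℝ)), hm]
    simp
  have v4' : ∫ p : ℝ × ℝ, 1 * p.2 ^ 4 ∂(μ.prod μ) = m := by
    rw [integral_prod_mul (fun _ => (1 : ℝ)) (fun x => x ^ 4), hm]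
    simp
  have v2 : ∫ p : ℝ × ℝ, p.1 ^ 2 * 1 ∂(μ.prod μ) = 1 := by
    rw [integral_prod_mul (fun x => x ^ 2) (fun _ => (1 : ℝ)), h2]
    simp
  have v2' : ∫ p : ℝ × ℝ, 1 * p.2 ^ 2 ∂(μ.prod μ) = 1 := by
    rw [integral_prod_mul (fun _ => (1 : ℝ)) (fun x => x ^ 2), h2]
    simp
  have v22 : ∫ p : ℝ × ℝ, 2 * (p.1 ^ 2 * p.2 ^ 2) ∂(μ.prod μ) = 2 := by
    rw [integral_const_mul, integral_prod_mul (fun x => x ^ 2) (fun x => x ^ 2), h2]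
    norm_num
  have v11 : ∫ p : ℝ × ℝ, 2 * (p.1 * p.2) ∂(μ.prod μ) = 0 := by
    rw [integral_const_mul, integral_prod_mul (fun x => x) (fun x => x), h1]
    norm_num
  have d1 := ((b2.add b2').sub (b11.const_mul 2)).const_mul c
  have d2 := ((b4.add b4').add (b22.const_mul 2)).const_mul c⁻¹
  rw [← hP, ← Real.norm_eq_abs]
  refine (norm_integral_le_of_norm_le ((d1.add d2).const_mul (L / 8))
    (ae_of_all _ fun p => ?_)).trans (le_of_eq ?_)
  · rw [Real.norm_eq_abs]
    simp only [P]
    rw [abs_div, abs_mul, abs_of_pos (two_pos : (0 : ℝ) < 2)]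
    have hx := abs_exchange_le hG hL p.1 p.2
    have hy : |p.1 - p.2| * (p.1 ^ 2 + p.2 ^ 2)
        ≤ (c * (p.1 - p.2) ^ 2 + c⁻¹ * (p.1 ^ 2 + p.2 ^ 2) ^ 2) / 2 := by
      have : (c * (p.1 - p.2) ^ 2 + c⁻¹ * (p.1 ^ 2 + p.2 ^ 2) ^ 2) / 2
          - |p.1 - p.2| * (p.1 ^ 2 + p.2 ^ 2)
          = c⁻¹ * (c * |p.1 - p.2| - (p.1 ^ 2 + p.2 ^ 2)) ^ 2 / 2 := by
        have := sq_abs (p.1 - p.2)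
        field_simp
        linear_combination -c ^ 2 * this
      have : 0 ≤ c⁻¹ * (c * |p.1 - p.2| - (p.1 ^ 2 + p.2 ^ 2)) ^ 2 / 2 := by positivity
      linarith
    have hz := mul_le_mul_of_nonneg_left hx (abs_nonneg (p.1 - p.2))
    simp only [Pi.add_apply, Pi.sub_apply]
    nlinarith [mul_le_mul_of_nonneg_left hy hL0]
  · rw [integral_const_mul, integral_add' d1 d2, integral_const_mul c, integral_const_mul c⁻¹,
      integral_sub' (b2.add b2') (b11.const_mul 2), integral_add' b2 b2',
      integral_add' (b4.add b4') (b22.const_mul 2), integral_add' b4 b4',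
      v4, v4', v2, v2', v22, v11]
    field_simp
    linear_combination -4 * L * hcsq

end OneDimensional

section Perturbation

variable {Ω : Type*} [MeasureSpace Ω] [IsProbabilityMeasure (ℙ : Measure Ω)]

/-- Stein-type comparison for one independent coordinate `X` entering linearly with a random
coefficient. -/
lemma abs_integral_perturbation_le {f f' : ℝ → ℝ} (hf : ∀ x, HasDerivAt f (f' x) x)
    (hfb : ∀ x, |f x| ≤ 1) (hfb' : ∀ x, |f' x| ≤ 1) (hfL : ∀ x y, |f' x - f' y| ≤ 2 * |x - y|)
    {X S R : Ω → ℝ} {m : ℝ} (hX : Measurable X) (hS : Measurable S) (hR : Measurable R)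
    (hind : IndepFun X (fun ω => (S ω, R ω)) ℙ) (hX4 : MemLp X 4 ℙ) (hS4 : MemLp S 4 ℙ)
    (h1 : ∫ ω, X ω = 0) (h2 : ∫ ω, X ω ^ 2 = 1) (hm : ∫ ω, X ω ^ 4 = m) :
    |∫ ω, (X ω * S ω * f (R ω + 2 * X ω * S ω) - 2 * S ω ^ 2 * f' (R ω + 2 * X ω * S ω))|
      ≤ 4 * √(m + 1) * ∫ ω, |S ω| ^ 3 := by
  have hfc : Continuous f := continuous_iff_continuousAt.2 fun x => (hf x).continuousAt
  have hfc' : Continuous f' :=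
    (LipschitzWith.of_dist_le_mul (K := 2) fun x y => by simpa [Real.dist_eq] using hfL x y).continuous
  set μ := Measure.map X ℙ with hμ
  set ν := Measure.map (fun ω => (S ω, R ω)) ℙ with hν
  have : IsProbabilityMeasure μ := Measure.isProbabilityMeasure_map hX.aemeasurable
  have : IsProbabilityMeasure ν := Measure.isProbabilityMeasure_map (by fun_prop)
  have hSR : Measurable fun ω => (S ω, R ω) := hS.prodMk hR
  have hmap : Measure.map (fun ω => (X ω, (S ω, R ω))) ℙ = μ.prod ν :=
    (indepFun_iff_map_prod_eq_prod_map_map hX.aemeasurable hSR.aemeasurable).1 hind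
  set H : ℝ × (ℝ × ℝ) → ℝ := fun p => p.1 * p.2.1 * f (p.2.2 + 2 * p.1 * p.2.1)
    - 2 * p.2.1 ^ 2 * f' (p.2.2 + 2 * p.1 * p.2.1) with hH
  have hHc : Continuous H := by fun_prop
  have hX2 : MemLp X 2 ℙ := hX4.mono_exponent (by norm_num)
  have hS2 : MemLp S 2 ℙ := hS4.mono_exponent (by norm_num)
  have hS3 : Integrable (fun ω => |S ω| ^ 3) :=
    (hS4.mono_exponent (p := 3) (by norm_num)).integrable_norm_pow (by norm_num)
  have hHi : Integrable H (μ.prod ν) := by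
    rw [← hmap, integrable_map_measure hHc.aestronglyMeasurable (by fun_prop)]
    have hXS : Integrable (fun ω => X ω * S ω) := hX2.integrable_mul hS2
    have hSS : Integrable (fun ω => 2 * S ω ^ 2) := hS2.integrable_sq.const_mul 2
    have hmeas : Measurable fun ω => R ω + 2 * X ω * S ω := by fun_prop
    exact (hXS.mul_bdd (hfc.measurable.comp hmeas).aestronglyMeasurable
      (ae_of_all _ fun ω => hfb _)).sub (hSS.mul_bdd
        (hfc'.measurable.comp hmeas).aestronglyMeasurable (ae_of_all _ fun ω => hfb' _))
  have hI : ∫ ω, (X ω * S ω * f (R ω + 2 * X ω * S ω)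
      - 2 * S ω ^ 2 * f' (R ω + 2 * X ω * S ω)) = ∫ q, ∫ x, H (x, q) ∂μ ∂ν := by
    rw [← integral_prod_symm _ hHi, ← hmap, integral_map (by fun_prop) hHc.aestronglyMeasurable]
  have hνS : ∫ ω, |S ω| ^ 3 = ∫ q : ℝ × ℝ, |q.1| ^ 3 ∂ν := by
    rw [hν, integral_map hSR.aemeasurable (by fun_prop)]
  have hνi : Integrable (fun q : ℝ × ℝ => |q.1| ^ 3) ν := by
    rw [hν, integrable_map_measure (by fun_prop) hSR.aemeasurable]
    exact hS3
  rw [hI, hνS, ← integral_const_mul, ← Real.norm_eq_abs]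
  refine norm_integral_le_of_norm_le (hνi.const_mul _) (ae_of_all _ fun q => ?_)
  obtain ⟨s, r⟩ := q
  have e : ∀ x, H (x, (s, r)) = s * (x * f (r + 2 * x * s) - 2 * s * f' (r + 2 * x * s)) :=
    fun x => by
      simp only [hH]
      ring
  simp only [e]
  have hlin : ∀ x, HasDerivAt (fun x => r + 2 * x * s) (2 * s) x := fun x => by
    have := (((hasDerivAt_id x).const_mul 2).mul_const s).const_add r
    simpa using this
  have hb := abs_integral_zero_bias_le (μ := μ) (G := fun x => f (r + 2 * x * s))
    (g := fun x => 2 * s * f' (r + 2 * x * s)) (L := 8 * s ^ 2) (m := m) (K := 1 + 2 * |s|)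
    ((memLp_map_measure_iff (by fun_prop) hX.aemeasurable).2 hX4)
    (by rw [hμ, integral_map hX.aemeasurable (by fun_prop), h1])
    (by rw [hμ, integral_map hX.aemeasurable (by fun_prop), h2])
    (by rw [hμ, integral_map hX.aemeasurable (by fun_prop), hm])
    (fun x => ((hf _).comp x (hlin x)).congr_deriv (by ring))
    (fun x y => by
      have := hfL (r + 2 * x * s) (r + 2 * y * s)
      have e2 : r + 2 * x * s - (r + 2 * y * s) = 2 * s * (x - y) := by ring
      rw [e2, abs_mul] at this
      rw [← mul_sub, abs_mul]
      refine (mul_le_mul_of_nonneg_left this (abs_nonneg _)).trans (le_of_eq ?_)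
      rw [abs_mul, abs_two]
      linear_combination 8 * |x - y| * sq_abs s)
    (by positivity)
    (fun x => (hfb _).trans (by linarith [abs_nonneg s]))
    (fun x => by
      rw [abs_mul, abs_mul, abs_two]
      nlinarith [hfb' (r + 2 * x * s), abs_nonneg s])
  rw [integral_const_mul, norm_mul, Real.norm_eq_abs, Real.norm_eq_abs]
  refine (mul_le_mul_of_nonneg_left hb (abs_nonneg _)).trans (le_of_eq ?_)
  rw [← sq_abs s]
  ring

end Perturbation

section Moments

variable {Ω : Type*} [MeasureSpace Ω] {ι : Type*} {X : ι → Ω → ℝ}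

/-- A coordinate of an independent family is independent of the family with that coordinate
set to zero. -/
lemma indepFun_update_zero [Fintype ι] [DecidableEq ι] (hX : iIndepFun X ℙ)
    (hmeas : ∀ k, Measurable (X k)) (k : ι) :
    IndepFun (X k) (fun ω => Function.update (fun j => X j ω) k 0) ℙ := by
  have h := hX.indepFun_finset {k} {k}ᶜ disjoint_compl_right hmeas
  have hm : Measurable fun y : ({k} : Finset ι) → ℝ => y ⟨k, Finset.mem_singleton_self k⟩ :=
    measurable_pi_apply _
  have hψ : Measurable fun (y : ({k}ᶜ : Finset ι) → ℝ) (j : ι) =>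
      if hj : j ∈ ({k}ᶜ : Finset ι) then y ⟨j, hj⟩ else 0 := by
    refine measurable_pi_iff.2 fun j => ?_
    by_cases hj : j ∈ ({k}ᶜ : Finset ι)
    · simp only [hj, dite_true]
      exact measurable_pi_apply _
    · simp only [hj, dite_false]
      fun_prop
  have e : (fun ω => Function.update (fun j => X j ω) k 0) = fun ω (j : ι) =>
      if j ∈ ({k}ᶜ : Finset ι) then X j ω else 0 := by
    funext ω j
    by_cases hj : j = k
    · subst hj
      simp
    · simp [hj]
  rw [e]
  exact h.comp hm hψ

lemma integral_mul_eq_zero_of_ne [Fintype ι] [DecidableEq ι] (hX : iIndepFun X ℙ)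
    (hmeas : ∀ k, Measurable (X k))
    (h1 : ∀ k, ∫ ω, X k ω = 0) {i j k l : ι} (hj : j ≠ i) (hk : k ≠ i) (hl : l ≠ i) :
    ∫ ω, X i ω * (X j ω * (X k ω * X l ω)) = 0 := by
  have h := (indepFun_update_zero hX hmeas i).comp (φ := id)
    (ψ := fun y => y j * (y k * y l)) measurable_id (by fun_prop)
  have e := h.integral_fun_mul_eq_mul_integral (hmeas i).aestronglyMeasurable
    (Measurable.aestronglyMeasurable (by fun_prop))
  simpa [hj, hk, hl, h1] using e

lemma integral_mul_eq_ite [DecidableEq ι] (hX : iIndepFun X ℙ)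
    (hmeas : ∀ k, Measurable (X k))
    (h1 : ∀ k, ∫ ω, X k ω = 0) (h2 : ∀ k, ∫ ω, X k ω ^ 2 = 1) (i j : ι) :
    ∫ ω, X i ω * X j ω = if i = j then 1 else 0 := by
  split_ifs with hij
  · subst hij
    simpa [sq] using h2 i
  · have := (hX.indepFun hij).integral_fun_mul_eq_mul_integral
      (hmeas i).aestronglyMeasurable (hmeas j).aestronglyMeasurable
    rw [this, h1, zero_mul]

lemma integral_sq_mul_sq (hX : iIndepFun X ℙ) (hmeas : ∀ k, Measurable (X k))
    (h2 : ∀ k, ∫ ω, X k ω ^ 2 = 1) {i j : ι} (hij : i ≠ j) :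
    ∫ ω, X i ω ^ 2 * X j ω ^ 2 = 1 := by
  have := ((hX.indepFun hij).comp (φ := fun x => x ^ 2) (ψ := fun x => x ^ 2) (by fun_prop)
    (by fun_prop)).integral_fun_mul_eq_mul_integral
      (Measurable.aestronglyMeasurable (by fun_prop)) (Measurable.aestronglyMeasurable (by fun_prop))
  simpa [h2] using this

/-- The mixed fourth moments of an independent standardized family. -/
lemma integral_mul_mul_mul_eq [Fintype ι] [DecidableEq ι] (hX : iIndepFun X ℙ)
    (hmeas : ∀ k, Measurable (X k))
    (h1 : ∀ k, ∫ ω, X k ω = 0) (h2 : ∀ k, ∫ ω, X k ω ^ 2 = 1) {m : ℝ}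
    (h4 : ∀ k, ∫ ω, X k ω ^ 4 = m) (i j k l : ι) :
    ∫ ω, (X i ω * X j ω) * (X k ω * X l ω) =
      (if i = j then if k = l then 1 else 0 else 0)
        + (if i = k then if j = l then 1 else 0 else 0)
        + (if i = l then if j = k then 1 else 0 else 0)
        + (if i = j then if i = k then if i = l then m - 3 else 0 else 0 else 0) := by
  have z := fun {i j k l : ι} => integral_mul_eq_zero_of_ne hX hmeas h1 (i := i) (j := j)
    (k := k) (l := l)
  have s := fun {i j : ι} => integral_sq_mul_sq hX hmeas h2 (i := i) (j := j)
  have c1 : (fun ω => X i ω * X j ω * (X k ω * X l ω))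
      = fun ω => X i ω * (X j ω * (X k ω * X l ω)) := by funext; ring
  have c2 : (fun ω => X i ω * X j ω * (X k ω * X l ω))
      = fun ω => X j ω * (X i ω * (X k ω * X l ω)) := by funext; ring
  have c3 : (fun ω => X i ω * X j ω * (X k ω * X l ω))
      = fun ω => X k ω * (X i ω * (X j ω * X l ω)) := by funext; ring
  by_cases hij : i = j
  · subst hij
    by_cases hkl : k = l
    · subst hkl
      by_cases hik : i = k
      · subst hik
        have e : (fun ω => X i ω * X i ω * (X i ω * X i ω)) = fun ω => X i ω ^ 4 := by
          funext; ring
        rw [e, h4]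
        simp
        ring
      · have e : (fun ω => X i ω * X i ω * (X k ω * X k ω)) = fun ω => X i ω ^ 2 * X k ω ^ 2 := by
          funext; ring
        rw [e, s hik]
        simp [hik]
    · by_cases hik : i = k
      · subst hik
        have e : (fun ω => X i ω * X i ω * (X i ω * X l ω))
            = fun ω => X l ω * (X i ω * (X i ω * X i ω)) := by funext; ring
        rw [e, z hkl hkl hkl]
        simp [hkl]
      · rw [c3, z hik hik (Ne.symm hkl)]
        simp [hkl, hik]
  · by_cases hik : i = k
    · subst hik
      by_cases hjl : j = l
      · subst hjl
        have e : (fun ω => X i ω * X j ω * (X i ω * X j ω)) = fun ω => X i ω ^ 2 * X j ω ^ 2 := by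
          funext; ring
        rw [e, s hij]
        simp [hij]
      · rw [c2, z hij hij (Ne.symm hjl)]
        simp [hij, hjl, Ne.symm hij]
    · by_cases hil : i = l
      · subst hil
        by_cases hjk : j = k
        · subst hjk
          have e : (fun ω => X i ω * X j ω * (X j ω * X i ω))
              = fun ω => X i ω ^ 2 * X j ω ^ 2 := by funext; ring
          rw [e, s hij]
          simp [hij]
        · rw [c2, z hij (Ne.symm hjk) hij]
          simp [hij, hik, hjk]
      · rw [c1, z (Ne.symm hij) (Ne.symm hik) (Ne.symm hil)]
        simp [hij, hik, hil]

lemma memLp_mul_of_memLp_four {U V : Ω → ℝ} (hU : MemLp U 4 ℙ) (hV : MemLp V 4 ℙ) :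
    MemLp (fun ω => U ω * V ω) 2 ℙ := by
  have : ENNReal.HolderTriple 4 4 2 := ⟨by
    rw [← two_mul, show (4 : ENNReal) = 2 * 2 by norm_num,
      ENNReal.mul_inv (by simp) (by simp), ← mul_assoc,
      ENNReal.mul_inv_cancel (by simp) (by simp), one_mul]⟩
  exact hV.mul hU

/-- The second moment of a quadratic form in an independent standardized family. -/
lemma integral_quadratic_form_sq [Fintype ι] [DecidableEq ι] (hX : iIndepFun X ℙ)
    (hmeas : ∀ k, Measurable (X k))
    (hL : ∀ k, MemLp (X k) 4 ℙ)
    (h1 : ∀ k, ∫ ω, X k ω = 0) (h2 : ∀ k, ∫ ω, X k ω ^ 2 = 1) {m : ℝ}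
    (h4 : ∀ k, ∫ ω, X k ω ^ 4 = m) (C : ι → ι → ℝ) (hC : ∀ i j, C i j = C j i) :
    ∫ ω, (∑ i, ∑ j, C i j * (X i ω * X j ω)) ^ 2
      = (∑ i, C i i) ^ 2 + 2 * ∑ i, ∑ j, C i j ^ 2 + (m - 3) * ∑ i, C i i ^ 2 := by
  have hL2 := fun i j => memLp_mul_of_memLp_four (hL i) (hL j)
  have hint : ∀ i j k l, Integrable (fun ω => C i j * C k l *
      ((X i ω * X j ω) * (X k ω * X l ω))) := fun i j k l =>
    ((hL2 i j).integrable_mul (hL2 k l)).const_mul _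
  have e : (fun ω => (∑ i, ∑ j, C i j * (X i ω * X j ω)) ^ 2)
      = fun ω => ∑ i, ∑ j, ∑ k, ∑ l, C i j * C k l * ((X i ω * X j ω) * (X k ω * X l ω)) := by
    funext ω
    rw [sq, Finset.sum_mul]
    refine Finset.sum_congr rfl fun i _ => ?_
    rw [Finset.sum_mul]
    refine Finset.sum_congr rfl fun j _ => ?_
    rw [Finset.mul_sum]
    refine Finset.sum_congr rfl fun k _ => ?_
    rw [Finset.mul_sum]
    refine Finset.sum_congr rfl fun l _ => ?_
    ring
  rw [e, integral_finsetSum _ fun i _ => integrable_finsetSum _ fun j _ =>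
    integrable_finsetSum _ fun k _ => integrable_finsetSum _ fun l _ => hint i j k l]
  have e2 : ∀ i, ∫ ω, ∑ j, ∑ k, ∑ l, C i j * C k l * ((X i ω * X j ω) * (X k ω * X l ω))
      = ∑ j, ∑ k, ∑ l, C i j * C k l * ∫ ω, (X i ω * X j ω) * (X k ω * X l ω) := fun i => by
    rw [integral_finsetSum _ fun j _ => integrable_finsetSum _ fun k _ =>
      integrable_finsetSum _ fun l _ => hint i j k l]
    refine Finset.sum_congr rfl fun j _ => ?_
    rw [integral_finsetSum _ fun k _ => integrable_finsetSum _ fun l _ => hint i j k l]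
    refine Finset.sum_congr rfl fun k _ => ?_
    rw [integral_finsetSum _ fun l _ => hint i j k l]
    exact Finset.sum_congr rfl fun l _ => integral_const_mul _ _
  simp only [e2, integral_mul_mul_mul_eq hX hmeas h1 h2 h4, mul_add, Finset.sum_add_distrib,
    mul_ite, mul_one, mul_zero, Finset.sum_ite_eq, Finset.mem_univ, if_true,
    Finset.sum_ite_irrel, Finset.sum_const_zero]
  have f1 : ∑ i, ∑ j, C i i * C j j = (∑ i, C i i) ^ 2 := by
    rw [sq, Finset.sum_mul_sum]
  have f2 : ∀ i j, C i j * C j i = C i j ^ 2 := fun i j => by rw [hC j i, sq]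
  have f3 : ∑ i, C i i * C i i * (m - 3) = (m - 3) * ∑ i, C i i ^ 2 := by
    rw [Finset.mul_sum]
    exact Finset.sum_congr rfl fun i _ => by ring
  rw [f1, f3]
  simp only [f2, ← sq]
  ring

end Moments

section QuadraticForm

variable {Ω : Type*} [MeasureSpace Ω] {ι : Type*} [Fintype ι] {X : ι → Ω → ℝ}

lemma integral_abs_le_sqrt_integral_sq [IsProbabilityMeasure (ℙ : Measure Ω)] {U : Ω → ℝ}
    (hU : MemLp U 2 ℙ) : ∫ ω, |U ω| ≤ √(∫ ω, U ω ^ 2) := by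
  have h := variance_nonneg |U| ℙ
  rw [variance_eq_sub hU.abs] at h
  simp only [Pi.pow_apply, Pi.abs_apply, sq_abs] at h
  exact Real.le_sqrt_of_sq_le (by linarith)

variable [DecidableEq ι]

lemma integral_linear_form_pow_four_le (hX : iIndepFun X ℙ)
    (hmeas : ∀ k, Measurable (X k)) (hL : ∀ k, MemLp (X k) 4 ℙ)
    (h1 : ∀ k, ∫ ω, X k ω = 0) (h2 : ∀ k, ∫ ω, X k ω ^ 2 = 1) {m : ℝ} (hm : 0 ≤ m)
    (h4 : ∀ k, ∫ ω, X k ω ^ 4 = m) (b : ι → ℝ) :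
    ∫ ω, (∑ j, b j * X j ω) ^ 4 ≤ (m + 3) * (∑ j, b j ^ 2) ^ 2 := by
  have e : ∀ ω, (∑ j, b j * X j ω) ^ 4 = (∑ i, ∑ j, b i * b j * (X i ω * X j ω)) ^ 2 := fun ω => by
    rw [show (4 : ℕ) = 2 * 2 from rfl, pow_mul, sq (∑ j, b j * X j ω), Finset.sum_mul_sum]
    congr 1
    exact Finset.sum_congr rfl fun i _ => Finset.sum_congr rfl fun j _ => by ring
  simp only [e]
  rw [integral_quadratic_form_sq hX hmeas hL h1 h2 h4 _ fun i j => mul_comm _ _]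
  have e1 : ∑ i, ∑ j, (b i * b j) ^ 2 = (∑ j, b j ^ 2) ^ 2 := by
    rw [sq (∑ j, b j ^ 2), Finset.sum_mul_sum]
    exact Finset.sum_congr rfl fun i _ => Finset.sum_congr rfl fun j _ => by ring
  have e2 : ∑ i, (b i * b i) ^ 2 ≤ (∑ j, b j ^ 2) ^ 2 := by
    have := Finset.sum_sq_le_sq_sum_of_nonneg (s := Finset.univ) (f := fun j => b j ^ 2)
      fun i _ => sq_nonneg _
    refine le_trans (le_of_eq (Finset.sum_congr rfl fun i _ => by ring)) this
  have e3 : 0 ≤ ∑ i, (b i * b i) ^ 2 := Finset.sum_nonneg fun i _ => sq_nonneg _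
  rw [e1]
  simp only [← sq] at *
  nlinarith

/-- Removing one coordinate from a symmetric quadratic form with vanishing diagonal. -/
lemma quadratic_form_update_zero {a : ι → ι → ℝ} (hsymm : ∀ k l, a k l = a l k)
    (hdiag : ∀ k, a k k = 0) (x : ι → ℝ) (k : ι) :
    ∑ i, ∑ j, a i j * (Function.update x k 0 i * Function.update x k 0 j)
      = ∑ i, ∑ j, a i j * (x i * x j) - 2 * x k * ∑ l, a k l * x l := by
  have hu : ∀ i, Function.update x k 0 i = x i - if i = k then x k else 0 := fun i => by
    by_cases h : i = k
    · subst h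
      simp
    · simp [h]
  have e : ∀ i j, a i j * (Function.update x k 0 i * Function.update x k 0 j)
      = a i j * (x i * x j) - (if i = k then a k j * (x k * x j) else 0)
        - (if j = k then a k i * (x i * x k) else 0) := fun i j => by
    rw [hu, hu]
    by_cases hi : i = k
    · subst hi
      by_cases hj : j = i
      · subst hj
        simp [hdiag]
      · simp [hj]
    · by_cases hj : j = k
      · subst hj
        simp [hi, hsymm i j]
      · simp [hi, hj]
  simp only [e, Finset.sum_sub_distrib, Finset.sum_ite_irrel, Finset.sum_const_zero,
    Finset.sum_ite_eq', Finset.mem_univ, if_true]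
  have f1 : ∑ j, a k j * (x k * x j) = x k * ∑ l, a k l * x l := by
    rw [Finset.mul_sum]
    exact Finset.sum_congr rfl fun i _ => by ring
  have f2 : ∑ j, a k j * (x j * x k) = x k * ∑ l, a k l * x l := by
    rw [Finset.mul_sum]
    exact Finset.sum_congr rfl fun i _ => by ring
  rw [f1, f2]
  ring

lemma integral_abs_one_sub_two_mul_sum_sq_le [IsProbabilityMeasure (ℙ : Measure Ω)]
    (hX : iIndepFun X ℙ)
    (hmeas : ∀ k, Measurable (X k)) (hL : ∀ k, MemLp (X k) 4 ℙ)
    (h1 : ∀ k, ∫ ω, X k ω = 0) (h2 : ∀ k, ∫ ω, X k ω ^ 2 = 1) {m : ℝ}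
    (h4 : ∀ k, ∫ ω, X k ω ^ 4 = m) {a : ι → ι → ℝ} (ha : ∑ k, ∑ l, a k l ^ 2 = 1 / 2) :
    ∫ ω, |1 - 2 * ∑ k, (∑ l, a k l * X l ω) ^ 2| ≤
      2 * √(m * ∑ l, (∑ k, a k l ^ 2) ^ 2 + 2 * ∑ l, ∑ p, (∑ k, a k l * a k p) ^ 2) := by
  set C : ι → ι → ℝ := fun l p => ∑ k, a k l * a k p with hC
  set T : Ω → ℝ := fun ω => ∑ l, ∑ p, C l p * (X l ω * X p ω) with hT
  have hTe : ∀ ω, ∑ k, (∑ l, a k l * X l ω) ^ 2 = T ω := fun ω => by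
    have e : T ω = ∑ l, ∑ k, ∑ p, a k l * a k p * (X l ω * X p ω) := by
      refine Finset.sum_congr rfl fun l _ => ?_
      rw [Finset.sum_comm]
      exact Finset.sum_congr rfl fun p _ => Finset.sum_mul _ _ _
    rw [e, Finset.sum_comm]
    refine Finset.sum_congr rfl fun k _ => ?_
    rw [sq, Finset.sum_mul_sum]
    exact Finset.sum_congr rfl fun l _ => Finset.sum_congr rfl fun p _ => by ring
  have hXX := fun i j => memLp_mul_of_memLp_four (hL i) (hL j)
  have hTL : MemLp T 2 ℙ := memLp_finsetSum _ fun i _ => memLp_finsetSum _ fun j _ =>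
    (hXX i j).const_mul _
  have hTi : Integrable T ℙ := hTL.integrable (by norm_num)
  have hCd : ∀ l, C l l = ∑ k, a k l ^ 2 := fun l => by simp only [hC, sq]
  have htr : ∑ l, C l l = 1 / 2 := by
    simp only [hCd]
    rw [Finset.sum_comm, ha]
  have hT1 : ∫ ω, T ω = 1 / 2 := by
    have hi : ∀ i j, Integrable (fun ω => C i j * (X i ω * X j ω)) ℙ := fun i j =>
      ((hXX i j).integrable (by norm_num)).const_mul _
    simp only [hT]
    rw [integral_finsetSum _ fun i _ => integrable_finsetSum _ fun j _ => hi i j, ← htr]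
    refine Finset.sum_congr rfl fun i _ => ?_
    rw [integral_finsetSum _ fun j _ => hi i j]
    simp [integral_const_mul, integral_mul_eq_ite hX hmeas h1 h2]
  have hT2 := integral_quadratic_form_sq hX hmeas hL h1 h2 h4 C fun i j => by
    simp only [hC, mul_comm]
  have hU : MemLp (fun ω => 1 - 2 * T ω) 2 ℙ := (memLp_const 1).sub (hTL.const_mul 2)
  simp only [hTe]
  refine (integral_abs_le_sqrt_integral_sq hU).trans ?_
  have e : ∫ ω, (1 - 2 * T ω) ^ 2 = 1 - 4 * (1 / 2) + 4 * ∫ ω, T ω ^ 2 := by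
    have e1 : (fun ω => (1 - 2 * T ω) ^ 2) = fun ω => (1 - 4 * T ω) + 4 * T ω ^ 2 := by
      funext
      ring
    have i1 : Integrable (fun ω => 1 - 4 * T ω) ℙ := (integrable_const _).sub (hTi.const_mul _)
    rw [e1, integral_add i1 (hTL.integrable_sq.const_mul _),
      integral_sub (integrable_const _) (hTi.const_mul _), integral_const_mul, integral_const_mul, hT1]
    simp
  have hA : 0 ≤ ∑ l, (∑ k, a k l ^ 2) ^ 2 := Finset.sum_nonneg fun i _ => sq_nonneg _
  rw [e, show ∫ ω, T ω ^ 2 = _ from hT2, htr]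
  simp only [hCd]
  rw [show (2 : ℝ) = √(2 ^ 2) by simp, ← Real.sqrt_mul (by positivity)]
  refine Real.sqrt_le_sqrt ?_
  simp only [Real.sqrt_sq zero_le_two]
  nlinarith

lemma integral_linear_form_sq (hX : iIndepFun X ℙ) (hmeas : ∀ k, Measurable (X k))
    (hL : ∀ k, MemLp (X k) 4 ℙ) (h1 : ∀ k, ∫ ω, X k ω = 0) (h2 : ∀ k, ∫ ω, X k ω ^ 2 = 1)
    [IsProbabilityMeasure (ℙ : Measure Ω)] (b : ι → ℝ) :
    ∫ ω, (∑ j, b j * X j ω) ^ 2 = ∑ j, b j ^ 2 := by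
  have hi : ∀ i j, Integrable (fun ω => b i * b j * (X i ω * X j ω)) ℙ := fun i j =>
    ((memLp_mul_of_memLp_four (hL i) (hL j)).integrable (by norm_num)).const_mul _
  have e : (fun ω => (∑ j, b j * X j ω) ^ 2)
      = fun ω => ∑ i, ∑ j, b i * b j * (X i ω * X j ω) := by
    funext ω
    rw [sq, Finset.sum_mul_sum]
    exact Finset.sum_congr rfl fun l _ => Finset.sum_congr rfl fun p _ => by ring
  rw [e, integral_finsetSum _ fun i _ => integrable_finsetSum _ fun j _ => hi i j]
  refine Finset.sum_congr rfl fun i _ => ?_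
  rw [integral_finsetSum _ fun j _ => hi i j]
  simp [integral_const_mul, integral_mul_eq_ite hX hmeas h1 h2, sq]

lemma sum_integral_abs_pow_three_le [IsProbabilityMeasure (ℙ : Measure Ω)] (hX : iIndepFun X ℙ)
    (hmeas : ∀ k, Measurable (X k)) (hL : ∀ k, MemLp (X k) 4 ℙ)
    (h1 : ∀ k, ∫ ω, X k ω = 0) (h2 : ∀ k, ∫ ω, X k ω ^ 2 = 1) {m : ℝ} (hm : 0 ≤ m)
    (h4 : ∀ k, ∫ ω, X k ω ^ 4 = m) {a : ι → ι → ℝ} (ha : ∑ k, ∑ l, a k l ^ 2 = 1 / 2) :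
    ∑ k, ∫ ω, |∑ l, a k l * X l ω| ^ 3 ≤ √((m + 3) * (∑ k, (∑ l, a k l ^ 2) ^ 2) / 2) := by
  set A := ∑ k, (∑ l, a k l ^ 2) ^ 2 with hA
  have hA0 : 0 < A := by
    obtain ⟨k, -, hk⟩ := Finset.exists_ne_zero_of_sum_ne_zero
      (show ∑ k, ∑ l, a k l ^ 2 ≠ 0 by rw [ha]; norm_num)
    exact Finset.sum_pos' (fun i _ => sq_nonneg _) ⟨k, Finset.mem_univ k, by positivity⟩
  set c := √((m + 3) * A / 2) with hc
  have hc0 : 0 < c := Real.sqrt_pos.2 (by positivity)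
  have hcsq : c ^ 2 = (m + 3) * A / 2 := Real.sq_sqrt (by positivity)
  have hSL : ∀ k, MemLp (fun ω => ∑ l, a k l * X l ω) 4 ℙ := fun k =>
    memLp_finsetSum _ fun l _ => (hL l).const_mul _
  have hk : ∀ k, ∫ ω, |∑ l, a k l * X l ω| ^ 3
      ≤ c * ∑ l, a k l ^ 2 + (4 * c)⁻¹ * ((m + 3) * (∑ l, a k l ^ 2) ^ 2) := fun k => by
    have i2 : Integrable (fun ω => (∑ l, a k l * X l ω) ^ 2) ℙ :=
      ((hSL k).mono_exponent (p := 2) (by norm_num)).integrable_sq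
    have i4 : Integrable (fun ω => (∑ l, a k l * X l ω) ^ 4) ℙ := by
      refine ((hSL k).integrable_norm_pow (by norm_num)).congr (ae_of_all _ fun ω => ?_)
      simp [← abs_pow, abs_of_nonneg (by positivity : 0 ≤ (∑ l, a k l * X l ω) ^ 4)]
    have i3 : Integrable (fun ω => |∑ l, a k l * X l ω| ^ 3) ℙ :=
      ((hSL k).mono_exponent (p := 3) (by norm_num)).integrable_norm_pow (by norm_num)
    refine (integral_mono i3 ((i2.const_mul c).add (i4.const_mul (4 * c)⁻¹)) fun ω => ?_).trans ?_
    · simp only [Pi.add_apply]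
      generalize ∑ l, a k l * X l ω = s
      rw [← sq_abs s, ← (by decide : Even 4).pow_abs s]
      have : c * |s| ^ 2 + (4 * c)⁻¹ * |s| ^ 4 - |s| ^ 3
          = (4 * c)⁻¹ * (|s| * (|s| - 2 * c)) ^ 2 := by
        field_simp
        ring
      have : 0 ≤ (4 * c)⁻¹ * (|s| * (|s| - 2 * c)) ^ 2 := by positivity
      linarith
    · rw [integral_add' (i2.const_mul c) (i4.const_mul _), integral_const_mul, integral_const_mul,
        integral_linear_form_sq hX hmeas hL h1 h2]
      have := integral_linear_form_pow_four_le hX hmeas hL h1 h2 hm h4 (a k)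
      gcongr
  refine (Finset.sum_le_sum fun k _ => hk k).trans (le_of_eq ?_)
  rw [Finset.sum_add_distrib, ← Finset.mul_sum, ha, ← Finset.mul_sum, ← Finset.mul_sum, ← hA]
  field_simp
  linear_combination -4 * hcsq

/-- The Stein functional of a standardized quadratic form. -/
lemma abs_integral_stein_quadratic_form_le [IsProbabilityMeasure (ℙ : Measure Ω)]
    {f f' : ℝ → ℝ} (hf : ∀ x, HasDerivAt f (f' x) x)
    (hfb : ∀ x, |f x| ≤ 1) (hfb' : ∀ x, |f' x| ≤ 1) (hfL : ∀ x y, |f' x - f' y| ≤ 2 * |x - y|)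
    (hX : iIndepFun X ℙ) (hmeas : ∀ k, Measurable (X k)) (hL : ∀ k, MemLp (X k) 4 ℙ)
    (h1 : ∀ k, ∫ ω, X k ω = 0) (h2 : ∀ k, ∫ ω, X k ω ^ 2 = 1) {m : ℝ}
    (h4 : ∀ k, ∫ ω, X k ω ^ 4 = m) {a : ι → ι → ℝ}
    (hsymm : ∀ k l, a k l = a l k) (hdiag : ∀ k, a k k = 0) {Q : Ω → ℝ}
    (hQ : ∀ ω, Q ω = ∑ k, ∑ l, a k l * (X k ω * X l ω)) :
    |∫ ω, (f' (Q ω) - Q ω * f (Q ω))| ≤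
      (∫ ω, |1 - 2 * ∑ k, (∑ l, a k l * X l ω) ^ 2|)
        + 4 * √(m + 1) * ∑ k, ∫ ω, |∑ l, a k l * X l ω| ^ 3 := by
  set S : ι → Ω → ℝ := fun k ω => ∑ l, a k l * X l ω with hS
  have hfc : Continuous f := continuous_iff_continuousAt.2 fun x => (hf x).continuousAt
  have hfc' : Continuous f' :=
    (LipschitzWith.of_dist_le_mul (K := 2) fun x y => by
      simpa [Real.dist_eq] using hfL x y).continuous
  have hSm : ∀ k, Measurable (S k) := fun k => by fun_prop
  have hQm : Measurable Q := by
    rw [show Q = _ from funext hQ]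
    fun_prop
  have hSL : ∀ k, MemLp (S k) 4 ℙ := fun k =>
    memLp_finsetSum _ fun l _ => (hL l).const_mul _
  have hSQ : ∀ ω, ∑ k, X k ω * S k ω = Q ω := fun ω => by
    rw [hQ]
    simp only [hS, Finset.mul_sum]
    exact Finset.sum_congr rfl fun k _ => Finset.sum_congr rfl fun l _ => by ring
  have hfQ : AEStronglyMeasurable (fun ω => f (Q ω)) ℙ :=
    (hfc.measurable.comp hQm).aestronglyMeasurable
  have hfQ' : AEStronglyMeasurable (fun ω => f' (Q ω)) ℙ :=
    (hfc'.measurable.comp hQm).aestronglyMeasurable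
  have hSS : ∀ k, Integrable (fun ω => S k ω ^ 2) ℙ := fun k =>
    ((hSL k).mono_exponent (p := 2) (by norm_num)).integrable_sq
  have hXS : ∀ k, Integrable (fun ω => X k ω * S k ω) ℙ := fun k =>
    (memLp_mul_of_memLp_four (hL k) (hSL k)).integrable (by norm_num)
  set D : ι → Ω → ℝ := fun k ω => X k ω * S k ω * f (Q ω) - 2 * S k ω ^ 2 * f' (Q ω) with hD
  have hDi : ∀ k, Integrable (D k) ℙ := fun k =>
    ((hXS k).mul_bdd hfQ (ae_of_all _ fun ω => hfb _)).sub
      (((hSS k).const_mul 2).mul_bdd hfQ' (ae_of_all _ fun ω => hfb' _))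
  have hDb : ∀ k, |∫ ω, D k ω| ≤ 4 * √(m + 1) * ∫ ω, |S k ω| ^ 3 := fun k => by
    have hind := (indepFun_update_zero hX hmeas k).comp (φ := id)
      (ψ := fun y => (∑ l, a k l * y l, ∑ i, ∑ j, a i j * (y i * y j)))
      measurable_id (by fun_prop)
    have hR : ∀ ω, ∑ i, ∑ j, a i j * (Function.update (fun j => X j ω) k 0 i
        * Function.update (fun j => X j ω) k 0 j) = Q ω - 2 * X k ω * S k ω := fun ω => by
      rw [quadratic_form_update_zero hsymm hdiag, hQ]
    have hSk : ∀ ω, ∑ l, a k l * Function.update (fun j => X j ω) k 0 l = S k ω := fun ω =>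
      Finset.sum_congr rfl fun l _ => by
        by_cases h : l = k
        · subst h
          simp [hdiag]
        · simp [h]
    simp only [Function.comp_def, id, hR, hSk] at hind
    have := abs_integral_perturbation_le hf hfb hfb' hfL (hmeas k) (hSm k)
      (R := fun ω => Q ω - 2 * X k ω * S k ω) (by fun_prop) hind (hL k) (hSL k) (h1 k) (h2 k) (h4 k)
    simpa only [sub_add_cancel] using this
  have hTi : Integrable (fun ω => 1 - 2 * ∑ k, S k ω ^ 2) ℙ :=
    (integrable_const _).sub ((integrable_finsetSum _ fun k _ => hSS k).const_mul _)
  have hTf : Integrable (fun ω => (1 - 2 * ∑ k, S k ω ^ 2) * f' (Q ω)) ℙ :=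
    hTi.mul_bdd hfQ' (ae_of_all _ fun ω => hfb' _)
  have e : (fun ω => f' (Q ω) - Q ω * f (Q ω))
      = fun ω => (1 - 2 * ∑ k, S k ω ^ 2) * f' (Q ω) - ∑ k, D k ω := by
    funext ω
    simp only [hD, Finset.sum_sub_distrib, ← Finset.sum_mul, hSQ, ← Finset.mul_sum]
    ring
  rw [e, integral_sub hTf (integrable_finsetSum _ fun k _ => hDi k),
    integral_finsetSum _ fun k _ => hDi k, Finset.mul_sum]
  refine (abs_sub _ _).trans (add_le_add ?_ ?_)
  · rw [← Real.norm_eq_abs]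
    refine norm_integral_le_of_norm_le hTi.abs (ae_of_all _ fun ω => ?_)
    rw [norm_mul]
    exact mul_le_of_le_one_right (norm_nonneg _) (hfb' _)
  · exact (Finset.abs_sum_le_sum_abs _ _).trans (Finset.sum_le_sum fun k _ => hDb k)

end QuadraticForm

theorem quadratic_form_wasserstein_bound
    {Ω : Type*} [MeasureSpace Ω] [IsProbabilityMeasure (ℙ : Measure Ω)]
    (n : ℕ) (X : Fin n → Ω → ℝ) (a : Fin n → Fin n → ℝ)
    (hmeas : ∀ k, Measurable (X k))
    (hindep : iIndepFun X ℙ)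
    (hiid : ∀ k l, IdentDistrib (X k) (X l) ℙ ℙ)
    (hcentered : ∀ k, ∫ ω, X k ω = 0)
    (hvar : ∀ k, ∫ ω, (X k ω) ^ 2 = 1)
    (h4int : ∀ k, Integrable (fun ω => (X k ω) ^ 4))
    (m4 : ℝ) (hm4 : ∀ k, ∫ ω, (X k ω) ^ 4 = m4)
    (hsymm : ∀ k l, a k l = a l k) (hdiag : ∀ k, a k k = 0)
    (hQvar : ∫ ω, (∑ k, ∑ l, a k l * X k ω * X l ω) ^ 2 = 1) :
    dW (Measure.map (fun ω => ∑ k, ∑ l, a k l * X k ω * X l ω) ℙ) stdGaussian ≤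
      2 * Real.sqrt (m4 * ∑ l, (∑ k, (a k l) ^ 2) ^ 2 +
          2 * ∑ l, ∑ p, (∑ k, a k l * a k p) ^ 2) +
        4 * Real.sqrt ((3 * m4 + m4 ^ 2) * ∑ k, (∑ l, (a k l) ^ 2) ^ 2) := by
  have hL : ∀ k, MemLp (X k) 4 ℙ := fun k => by
    rw [← integrable_norm_rpow_iff (hmeas k).aestronglyMeasurable (by norm_num) (by norm_num)]
    refine (h4int k).congr (Filter.Eventually.of_forall fun ω => ?_)
    have : ((4 : ENNReal).toReal) = ((4 : ℕ) : ℝ) := by norm_num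
    simp only [this, Real.rpow_natCast, Real.norm_eq_abs]
    exact ((by decide : Even 4).pow_abs _).symm
  have ha : ∑ k, ∑ l, a k l ^ 2 = 1 / 2 := by
    have h := integral_quadratic_form_sq hindep hmeas hL hcentered hvar hm4 a hsymm
    simp only [← mul_assoc, hQvar, hdiag] at h
    simp only [ne_eq, OfNat.ofNat_ne_zero, not_false_eq_true, zero_pow,
      Finset.sum_const_zero] at h
    linarith
  have hm1 : 1 ≤ m4 := by
    obtain ⟨k, -, -⟩ := Finset.exists_ne_zero_of_sum_ne_zero
      (show ∑ k, ∑ l, a k l ^ 2 ≠ 0 by rw [ha]; norm_num)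
    have hX2 : MemLp (fun ω => X k ω ^ 2) 2 ℙ := by
      simpa only [sq] using memLp_mul_of_memLp_four (hL k) (hL k)
    have h := variance_nonneg (fun ω => X k ω ^ 2) ℙ
    rw [variance_eq_sub hX2] at h
    simp only [Pi.pow_apply, ← pow_mul, Nat.reduceMul, hvar, hm4] at h
    linarith
  have hm0 : 0 ≤ m4 := zero_le_one.trans hm1
  have : Nonempty {h : ℝ → ℝ // LipschitzWith 1 h} := ⟨⟨id, LipschitzWith.id⟩⟩
  set Q : Ω → ℝ := fun ω => ∑ k, ∑ l, a k l * X k ω * X l ω with hQ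
  have hQm : Measurable Q := by fun_prop
  have hQL : Integrable Q ℙ := by
    refine integrable_finsetSum _ fun k _ => integrable_finsetSum _ fun l _ => ?_
    simp only [mul_assoc]
    exact ((memLp_mul_of_memLp_four (hL k) (hL l)).integrable (by norm_num)).const_mul _
  refine ciSup_le fun ⟨h, hh⟩ => ?_
  obtain ⟨f, f', hf, hst, hfb, hfb', hfL⟩ := exists_stein_solution hh
  simp only [_root_.stdGaussian]
  have hhi : Integrable (fun ω => h (Q ω)) ℙ := by
    refine (hQL.norm.add (integrable_const |h 0|)).mono'
      (hh.continuous.measurable.comp hQm).aestronglyMeasurable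
      (Filter.Eventually.of_forall fun ω => ?_)
    have := hh.dist_le_mul (Q ω) 0
    simp only [Real.dist_eq, NNReal.coe_one, one_mul, sub_zero] at this
    have h2 := abs_sub_abs_le_abs_sub (h (Q ω)) (h 0)
    simp only [Pi.add_apply, Real.norm_eq_abs]
    linarith
  have e : ∫ x, h x ∂(Measure.map Q ℙ) - ∫ x, h x ∂(gaussianReal 0 1)
      = ∫ ω, (f' (Q ω) - Q ω * f (Q ω)) := by
    simp only [hst]
    rw [integral_map hQm.aemeasurable hh.continuous.aestronglyMeasurable,
      integral_sub hhi (integrable_const _)]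
    simp
  rw [e]
  refine (abs_integral_stein_quadratic_form_le hf hfb hfb' hfL hindep hmeas hL hcentered hvar hm4
    hsymm hdiag fun ω => by simp only [hQ, mul_assoc]).trans (add_le_add ?_ ?_)
  · exact integral_abs_one_sub_two_mul_sum_sq_le hindep hmeas hL hcentered hvar hm4 ha
  · rw [mul_assoc]
    refine mul_le_mul_of_nonneg_left ((mul_le_mul_of_nonneg_left
      (sum_integral_abs_pow_three_le hindep hmeas hL hcentered hvar hm0 hm4 ha)
        (Real.sqrt_nonneg _)).trans ?_) (by norm_num)
    rw [← Real.sqrt_mul (by linarith)]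
    have hA : 0 ≤ ∑ k, (∑ l, a k l ^ 2) ^ 2 := Finset.sum_nonneg fun i _ => sq_nonneg _
    refine Real.sqrt_le_sqrt ?_
    nlinarith [mul_nonneg hA (mul_nonneg (sub_nonneg.2 hm1) (by linarith : 0 ≤ m4 + 3))]
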